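/- Let n ≥ 5 and 3 ≤ K ≤ n−2, let v ∈ {4,…,n} and u ∈ V with u < v. The upper representative inequality x_{u,v} + x_v ≤ 1 is facet-defining for P_{n,K} if and only if n ≥ 6 or {u,v} ≠ {4,5}. -/

import Mathlib

/-- A `K`-partition of `V = {1,…,n}`: a family of `K` nonempty pairwise disjoint
subsets of `V` (clusters) whose union is `V`. -/
structure KPartition (n K : ℕ) where
  parts : Finset (Finset ℕ)
  card_parts : parts.card = K
  parts_nonempty : ∀ C ∈ parts, C.Nonempty
  parts_disjoint : ∀ C ∈ parts, ∀ D ∈ parts, C ≠ D → Disjoint C D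
  parts_cover : parts.sup id = Finset.Icc 1 n

/-- The ambient space: one (symmetric) edge coordinate for each pair of vertices and one
representative coordinate for each vertex (only the coordinates of edges `uv ∈ E` and of
vertices `v ∈ {4,…,n}` are actually used; the remaining ones are affinely determined, so
affine dimensions agree with those in `ℝ^{|E|+n-3}`). -/
abbrev GPoint : Type := (ℕ × ℕ → ℝ) × (ℕ → ℝ)

open Classical in
/-- The characteristic vector of a `K`-partition: edge component `x_{u,v} = 1` iff `u` and `v`
lie in the same cluster; representative component `x_v = 1` (for `v ∈ {4,…,n}`) iff `v` is the
smallest element of its cluster. -/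
noncomputable def charVec (n K : ℕ) (π : KPartition n K) : GPoint :=
  ⟨fun p => if ∃ C ∈ π.parts, p.1 ∈ C ∧ p.2 ∈ C then 1 else 0,
   fun v => if 4 ≤ v ∧ ∃ C ∈ π.parts, v ∈ C ∧ ∀ w ∈ C, v ≤ w then 1 else 0⟩

/-- `P_{n,K}`: the convex hull of the characteristic vectors of all `K`-partitions. -/
noncomputable def PolyP (n K : ℕ) : Set GPoint :=
  convexHull ℝ {x | ∃ π : KPartition n K, x = charVec n K π}

/-- Affine dimension of a set: the rank of the direction of its affine span. -/
noncomputable def adim (s : Set GPoint) : ℕ :=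
  Module.finrank ℝ (affineSpan ℝ s).direction

/-- `f x ≤ b` is a valid inequality for `P_{n,K}` which is facet-defining. -/
def IsFacetLe (n K : ℕ) (f : GPoint → ℝ) (b : ℝ) : Prop :=
  (∀ x ∈ PolyP n K, f x ≤ b) ∧
  adim {x | x ∈ PolyP n K ∧ f x = b} + 1 = adim (PolyP n K)

/-- `f x ≥ b` is a valid inequality for `P_{n,K}` which is facet-defining. -/
def IsFacetGe (n K : ℕ) (f : GPoint → ℝ) (b : ℝ) : Prop :=
  (∀ x ∈ PolyP n K, b ≤ f x) ∧
  adim {x | x ∈ PolyP n K ∧ f x = b} + 1 = adim (PolyP n K)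

/-- Sum of the edge components of `x` over the edges with both endpoints in `A`. -/
noncomputable def edgeSum (A : Finset ℕ) (x : GPoint) : ℝ :=
  ∑ e ∈ A.offDiag.filter (fun e => e.1 < e.2), x.1 e

/-- The coloring `c` partitions `V` into exactly `K` classes, colored `0,…,K-1`. -/
def IsColoring (V : Finset ℕ) (K : ℕ) (c : ℕ → ℕ) : Prop :=
  (∀ i ∈ V, c i < K) ∧ ∀ t < K, ∃ i ∈ V, c i = t

/-- Indicator of `i` and `j` having the same color. -/
def sameInd (c : ℕ → ℕ) (i j : ℕ) : ℝ := if c i = c j then 1 else 0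

/-- Indicator of `w` being smallest in its color class. -/
def repInd (V : Finset ℕ) (c : ℕ → ℕ) (w : ℕ) : ℝ :=
  if ∀ z ∈ V, z < w → c z ≠ c w then 1 else 0

/-- The value at the coloring `c` of the linear form with edge coefficients `M` and representative
coefficients `b`. -/
noncomputable def formValue (V : Finset ℕ) (M : ℕ → ℕ → ℝ) (b : ℕ → ℝ) (c : ℕ → ℕ) : ℝ :=
  ∑ i ∈ V, ∑ j ∈ V, M i j * sameInd c i j + ∑ w ∈ V, b w * repInd V c w

theorem repInd_eq_one {V : Finset ℕ} {c : ℕ → ℕ} {w : ℕ}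
    (h : ∀ z ∈ V, z < w → c z ≠ c w) : repInd V c w = 1 := if_pos h

theorem repInd_eq_zero {V : Finset ℕ} {c : ℕ → ℕ} {w z : ℕ} (hz : z ∈ V) (hzw : z < w)
    (h : c z = c w) : repInd V c w = 0 := if_neg fun H => H z hz hzw h

/-- A coloring of `S` with `k` colors extends to a coloring of `V` with `K` colors, where new
vertices get new colors or the prescribed old color `j`. -/
theorem exists_coloring_extension (V : Finset ℕ) (j m : ℕ) : ∀ (S : Finset ℕ) (k : ℕ) (c₀ : ℕ → ℕ),
    S ⊆ V → IsColoring S k c₀ → j < k → S.card + m ≤ V.card →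
    ∃ c, IsColoring V (k + m) c ∧ (∀ s ∈ S, c s = c₀ s) ∧
      ∀ s ∈ V, s ∉ S → c s = j ∨ k ≤ c s := by
  induction m with
  | zero =>
    intro S k c₀ hS hc hj _
    refine ⟨fun s => if s ∈ S then c₀ s else j, ⟨?_, ?_⟩, ?_, ?_⟩
    · intro i _
      by_cases hi : i ∈ S
      · simpa [hi] using hc.1 i hi
      · simpa [hi] using hj
    · intro t ht
      obtain ⟨i, hi, hit⟩ := hc.2 t ht
      exact ⟨i, hS hi, by simpa [hi] using hit⟩
    · intro s hs
      simp [hs]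
    · intro s _ hs
      simp [hs]
  | succ m ih =>
    intro S k c₀ hS hc hj hcard
    obtain ⟨t, htV, htS⟩ : ∃ t ∈ V, t ∉ S :=
      Finset.exists_mem_notMem_of_card_lt_card (by omega)
    have hne : ∀ s ∈ S, s ≠ t := fun s hs h => htS (h ▸ hs)
    obtain ⟨c, h1, h2, h3⟩ := ih (insert t S) (k + 1) (Function.update c₀ t k)
      (Finset.insert_subset htV hS) ⟨by
        intro i hi
        rcases Finset.mem_insert.1 hi with rfl | hi
        · simp
        · rw [Function.update_of_ne (hne i hi)]
          exact (hc.1 i hi).trans (Nat.lt_succ_self k), by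
        intro r hr
        rcases Nat.lt_succ_iff_lt_or_eq.1 hr with hr | rfl
        · obtain ⟨i, hi, hir⟩ := hc.2 r hr
          exact ⟨i, Finset.mem_insert_of_mem hi, by rw [Function.update_of_ne (hne i hi), hir]⟩
        · exact ⟨t, Finset.mem_insert_self t S, by simp⟩⟩ (by omega)
      (by rw [Finset.card_insert_of_notMem htS]; omega)
    refine ⟨c, by rwa [add_assoc, add_comm 1 m] at h1, ?_, ?_⟩
    · intro s hs
      rw [h2 s (Finset.mem_insert_of_mem hs), Function.update_of_ne (hne s hs)]
    · intro s hsV hsS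
      by_cases hst : s = t
      · right
        rw [hst, h2 t (Finset.mem_insert_self t S)]
        simp
      · rcases h3 s hsV (by simp [hst, hsS]) with h | h
        · exact Or.inl h
        · exact Or.inr (by omega)

/-- A coloring with `K` colors has `K` representatives. -/
theorem sum_repInd {V : Finset ℕ} {K : ℕ} {c : ℕ → ℕ} (hc : IsColoring V K c) :
    ∑ w ∈ V, repInd V c w = K := by
  have h : (V.filter fun w => ∀ z ∈ V, z < w → c z ≠ c w).card = (Finset.range K).card := by
    refine Finset.card_bij (fun w _ => c w) ?_ ?_ ?_
    · intro w hw
      exact Finset.mem_range.2 (hc.1 w (Finset.mem_filter.1 hw).1)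
    · intro w hw w' hw' hww
      rw [Finset.mem_filter] at hw hw'
      rcases lt_trichotomy w w' with h | h | h
      · exact absurd hww (hw'.2 w hw.1 h)
      · exact h
      · exact absurd hww.symm (hw.2 w' hw'.1 h)
    · intro t ht
      obtain ⟨i, hi, hit⟩ := hc.2 t (Finset.mem_range.1 ht)
      have hne : (V.filter fun z => c z = t).Nonempty := ⟨i, by simp [hi, hit]⟩
      have hmem := Finset.min'_mem _ hne
      rw [Finset.mem_filter] at hmem
      refine ⟨_, Finset.mem_filter.2 ⟨hmem.1, ?_⟩, hmem.2⟩
      intro z hz hzw hcz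
      have hcz' := hcz.trans hmem.2
      have hle := Finset.min'_le (V.filter fun z => c z = t) z (Finset.mem_filter.2 ⟨hz, hcz'⟩)
      omega
  simp only [repInd]
  rw [Finset.sum_boole, h, Finset.card_range]

/-- The coloring `c` with `p` and `q` recolored. -/
def recolor (c : ℕ → ℕ) (p q s t : ℕ) : ℕ → ℕ := Function.update (Function.update c p s) q t

theorem recolor_right (c : ℕ → ℕ) (p q s t : ℕ) : recolor c p q s t q = t := by simp [recolor]

theorem recolor_left (c : ℕ → ℕ) {p q : ℕ} (h : p ≠ q) (s t : ℕ) : recolor c p q s t p = s := by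
  simp [recolor, h]

theorem recolor_of_ne (c : ℕ → ℕ) {p q i : ℕ} (hp : i ≠ p) (hq : i ≠ q) (s t : ℕ) :
    recolor c p q s t i = c i := by
  simp [recolor, hp, hq]

theorem sameInd_second_difference (c : ℕ → ℕ) {p q s t : ℕ} (hpq : p ≠ q) (hst : s ≠ t) (i j : ℕ) :
    sameInd (recolor c p q s s) i j - sameInd (recolor c p q s t) i j
      - sameInd (recolor c p q t s) i j + sameInd (recolor c p q t t) i j
      = (if i = p then if j = q then 2 else 0 else 0)
        + (if i = q then if j = p then 2 else 0 else 0) := by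
  have hqp := hpq.symm
  have hts := hst.symm
  unfold sameInd
  by_cases hip : i = p <;> by_cases hiq : i = q <;> by_cases hjp : j = p <;>
    by_cases hjq : j = q <;>
    simp [recolor, *] <;> (try subst_vars) <;> (try simp_all) <;> norm_num

/-- Second difference of a form with respect to recoloring two vertices. -/
theorem form_second_difference {V : Finset ℕ} {M : ℕ → ℕ → ℝ} (b : ℕ → ℝ) (c : ℕ → ℕ)
    {p q s t : ℕ} (hM : M q p = M p q) (hp : p ∈ V) (hq : q ∈ V) (hpq : p ≠ q) (hst : s ≠ t) :
    formValue V M b (recolor c p q s s) - formValue V M b (recolor c p q s t)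
      - formValue V M b (recolor c p q t s) + formValue V M b (recolor c p q t t)
      = 4 * M p q + ∑ w ∈ V, b w * (repInd V (recolor c p q s s) w
        - repInd V (recolor c p q s t) w - repInd V (recolor c p q t s) w
        + repInd V (recolor c p q t t) w) := by
  have h : ∑ i ∈ V, ∑ j ∈ V, M i j * (sameInd (recolor c p q s s) i j
      - sameInd (recolor c p q s t) i j
      - sameInd (recolor c p q t s) i j + sameInd (recolor c p q t t) i j) = 4 * M p q := by
    simp only [sameInd_second_difference c hpq hst, mul_add, Finset.sum_add_distrib, mul_ite,
      mul_zero]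
    simp only [Finset.sum_ite_irrel, Finset.sum_ite_eq', Finset.sum_const_zero, hp, hq, if_true, hM]
    ring
  simp only [formValue, mul_add, mul_sub, Finset.sum_add_distrib, Finset.sum_sub_distrib] at h ⊢
  linarith

theorem isColoring_recolor {V : Finset ℕ} {K : ℕ} {c : ℕ → ℕ} {p q s t : ℕ}
    (hc : IsColoring ((V.erase p).erase q) K c) (hs : s < K) (ht : t < K) :
    IsColoring V K (recolor c p q s t) := by
  refine ⟨fun i hi => ?_, fun r hr => ?_⟩
  · by_cases hiq : i = q
    · rw [hiq, recolor_right]; exact ht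
    by_cases hip : i = p
    · rw [hip, recolor_left c (fun h => hiq (hip.trans h))]; exact hs
    rw [recolor_of_ne c hip hiq]
    exact hc.1 i (by simp [hip, hiq, hi])
  · obtain ⟨i, hi, hir⟩ := hc.2 r hr
    simp only [Finset.mem_erase] at hi
    exact ⟨i, hi.2.2, by rw [recolor_of_ne c hi.2.1 hi.1, hir]⟩

theorem repInd_recolor_right_eq {V : Finset ℕ} {c : ℕ → ℕ} {p q s t t' x y : ℕ}
    (hx : x ∈ V) (hy : y ∈ V) (hxq : x < q) (hyq : y < q) (hxp : x ≠ p) (hyp : y ≠ p)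
    (hcx : c x = t) (hcy : c y = t') (w : ℕ) :
    repInd V (recolor c p q s t) w = repInd V (recolor c p q s t') w := by
  have key : ∀ {r z}, z ∈ V → z < q → z ≠ p → c z = r →
      ((∀ i ∈ V, i < w → recolor c p q s r i ≠ recolor c p q s r w) ↔
        w ≠ q ∧ ∀ i ∈ V, i ≠ q → i < w → Function.update c p s i ≠ Function.update c p s w) := by
    intro r z hz hzq hzp hcz
    have hzr : recolor c p q s r z = r := by rw [recolor_of_ne c hzp hzq.ne, hcz]
    constructor
    · intro h
      have hwq : w ≠ q := by
        rintro rfl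
        exact h z hz hzq (by rw [hzr, recolor_right])
      refine ⟨hwq, fun i hi hiq hiw => ?_⟩
      simpa [recolor, hiq, hwq] using h i hi hiw
    · rintro ⟨hwq, h⟩ i hi hiw
      by_cases hiq : i = q
      · have := h z hz hzq.ne (by omega)
        simp only [Function.update_of_ne hzp, hcz] at this
        rw [hiq, recolor_right, recolor, Function.update_of_ne hwq]
        exact this
      · simpa [recolor, hiq, hwq] using h i hi hiq hiw
  unfold repInd
  simp only [key hx hxq hxp hcx, key hy hyq hyp hcy]

section FaceForm

variable {n K u v : ℕ} {M : ℕ → ℕ → ℝ} {b : ℕ → ℝ} {κ : ℝ}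

/-- Base coloring with `v` alone in class `2`, `x` and `y` in classes `0` and `1`, and `y` the only
vertex of class `1`. -/
theorem exists_base_coloring (hK1 : 3 ≤ K) (hK2 : K + 2 ≤ n) {p q x y v : ℕ}
    (hp : p ∈ Finset.Icc 1 n) (hq : q ∈ Finset.Icc 1 n)
    (hx : x ∈ Finset.Icc 1 n) (hy : y ∈ Finset.Icc 1 n) (hv : v ∈ Finset.Icc 1 n)
    (hd : [p, q, x, y, v].Nodup) :
    ∃ c, IsColoring (((Finset.Icc 1 n).erase p).erase q) K c ∧ c x = 0 ∧ c y = 1 ∧ c v = 2 ∧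
      ∀ i ∈ Finset.Icc 1 n, i ≠ p → i ≠ q → i ≠ y → i ≠ v → c i ≠ 1 ∧ c i ≠ 2 := by
  simp only [List.nodup_cons, List.mem_cons, not_or, List.not_mem_nil, not_false_eq_true,
    List.nodup_nil, and_true] at hd
  obtain ⟨⟨hpq, hpx, hpy, hpv⟩, ⟨hqx, hqy, hqv⟩, ⟨hxy, hxv⟩, hyv⟩ := hd
  have hcard : (((Finset.Icc 1 n).erase p).erase q).card + 2 = n := by
    rw [Finset.card_erase_of_mem (by simp only [Finset.mem_erase]; exact ⟨Ne.symm hpq, hq⟩),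
      Finset.card_erase_of_mem hp, Nat.card_Icc]
    omega
  have hS3 : ({x, y, v} : Finset ℕ).card = 3 := Finset.card_eq_three.2 ⟨x, y, v, hxy, hxv, hyv, rfl⟩
  obtain ⟨c, h1, h2, h3⟩ := exists_coloring_extension (((Finset.Icc 1 n).erase p).erase q) 0 (K - 3)
    {x, y, v} 3 (fun i => if i = x then 0 else if i = y then 1 else 2) (by
      intro i hi
      simp only [Finset.mem_insert, Finset.mem_singleton] at hi
      simp only [Finset.mem_erase]
      rcases hi with rfl | rfl | rfl
      · exact ⟨Ne.symm hqx, Ne.symm hpx, hx⟩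
      · exact ⟨Ne.symm hqy, Ne.symm hpy, hy⟩
      · exact ⟨Ne.symm hqv, Ne.symm hpv, hv⟩)
    ⟨by intro i _; dsimp only; split_ifs <;> omega, by
      intro t ht
      interval_cases t
      · exact ⟨x, by simp, by simp⟩
      · exact ⟨y, by simp, by simp [Ne.symm hxy]⟩
      · exact ⟨v, by simp, by simp [Ne.symm hxv, Ne.symm hyv]⟩⟩ (by omega) (by omega)
  refine ⟨c, by rwa [Nat.add_sub_cancel' hK1] at h1, ?_, ?_, ?_, ?_⟩
  · rw [h2 x (by simp)]; simp
  · rw [h2 y (by simp)]; simp [Ne.symm hxy]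
  · rw [h2 v (by simp)]; simp [Ne.symm hxv, Ne.symm hyv]
  · intro i hi hip hiq hiy hiv
    by_cases hix : i = x
    · rw [hix, h2 x (by simp)]; simp
    · rcases h3 i (by simp only [Finset.mem_erase]; exact ⟨hiq, hip, hi⟩) (by simp [*]) with h | h
        <;> omega

/-- The form with coefficients `M`, `b` takes the value `κ` at every `K`-coloring of `{1,…,n}`
in which `v` has the color of `u` or is smallest in its class. -/
def ConstOnFace (n K u v : ℕ) (M : ℕ → ℕ → ℝ) (b : ℕ → ℝ) (κ : ℝ) : Prop :=
  ∀ c, IsColoring (Finset.Icc 1 n) K c →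
    (c u = c v ∨ ∀ z ∈ Finset.Icc 1 n, z < v → c z ≠ c v) →
    formValue (Finset.Icc 1 n) M b c = κ

theorem ConstOnFace.second_difference (h : ConstOnFace n K u v M b κ) (hK1 : 3 ≤ K) {p q : ℕ}
    (hM : M q p = M p q) (hp : p ∈ Finset.Icc 1 n) (hq : q ∈ Finset.Icc 1 n) (hpq : p ≠ q)
    (hpv : p ≠ v) (hqv : q ≠ v) {c : ℕ → ℕ}
    (hc : IsColoring (((Finset.Icc 1 n).erase p).erase q) K c) (hcv : c v = 2)
    (hv : ∀ i ∈ Finset.Icc 1 n, i ≠ p → i ≠ q → i ≠ v → c i ≠ 2) :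
    4 * M p q + ∑ w ∈ Finset.Icc 1 n, b w * (repInd (Finset.Icc 1 n) (recolor c p q 0 0) w
        - repInd (Finset.Icc 1 n) (recolor c p q 0 1) w
        - repInd (Finset.Icc 1 n) (recolor c p q 1 0) w
        + repInd (Finset.Icc 1 n) (recolor c p q 1 1) w) = 0 := by
  have hF : ∀ s < 2, ∀ t < 2, formValue (Finset.Icc 1 n) M b (recolor c p q s t) = κ := by
    intro s hs t ht
    refine h _ (isColoring_recolor hc (by omega) (by omega)) (Or.inr fun z hz hzv => ?_)
    rw [recolor_of_ne c (Ne.symm hpv) (Ne.symm hqv), hcv]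
    by_cases hzq : z = q
    · rw [hzq, recolor_right]; omega
    by_cases hzp : z = p
    · rw [hzp, recolor_left c hpq]; omega
    rw [recolor_of_ne c hzp hzq]
    exact hv z hz hzp hzq hzv.ne
  rw [← form_second_difference b c hM hp hq hpq zero_ne_one, hF 0 (by omega) 0 (by omega),
    hF 0 (by omega) 1 (by omega), hF 1 (by omega) 0 (by omega), hF 1 (by omega) 1 (by omega)]
  ring

theorem ConstOnFace.coeff_eq_zero (h : ConstOnFace n K u v M b κ) (hK1 : 3 ≤ K) (hK2 : K + 2 ≤ n)
    (hM : ∀ i j, M i j = M j i) (hv4 : 4 ≤ v) (hvn : v ≤ n) {p q : ℕ} (hp : 1 ≤ p) (hpq : p < q)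
    (hq : q ≤ n) (hq4 : 4 ≤ q) (hpv : p ≠ v) (hqv : q ≠ v) : M p q = 0 := by
  obtain ⟨x, y, hx, hy, hxy, hxq, hyq, hxp, hyp, hxv, hyv⟩ : ∃ x y, 1 ≤ x ∧ 1 ≤ y ∧ x ≠ y ∧ x < q ∧
      y < q ∧ x ≠ p ∧ y ≠ p ∧ x ≠ v ∧ y ≠ v := by
    by_cases h1 : p = 1
    · exact ⟨2, 3, by omega⟩
    by_cases h2 : p = 2
    · exact ⟨1, 3, by omega⟩
    · exact ⟨1, 2, by omega⟩
  have hpm : p ∈ Finset.Icc 1 n := Finset.mem_Icc.2 (by omega)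
  have hqm : q ∈ Finset.Icc 1 n := Finset.mem_Icc.2 (by omega)
  have hxm : x ∈ Finset.Icc 1 n := Finset.mem_Icc.2 (by omega)
  have hym : y ∈ Finset.Icc 1 n := Finset.mem_Icc.2 (by omega)
  obtain ⟨c, hc, hcx, hcy, hcv, hcr⟩ := exists_base_coloring hK1 hK2 hpm hqm hxm hym
    (Finset.mem_Icc.2 (by omega) : v ∈ Finset.Icc 1 n) (by simp; omega)
  have := h.second_difference hK1 (hM q p) hpm hqm hpq.ne hpv hqv hc hcv (fun i hi h1 h2 h3 => by
    by_cases hiy : i = y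
    · rw [hiy, hcy]; omega
    · exact (hcr i hi h1 h2 hiy h3).2)
  rw [Finset.sum_eq_zero] at this
  · linarith
  · intro w _
    rw [repInd_recolor_right_eq (s := 0) hxm hym hxq hyq hxp hyp hcx hcy w,
      repInd_recolor_right_eq (s := 1) hxm hym hxq hyq hxp hyp hcx hcy w]
    ring

theorem ConstOnFace.coeff_small (h : ConstOnFace n K u v M b κ) (hK1 : 3 ≤ K) (hK2 : K + 2 ≤ n)
    (hM : ∀ i j, M i j = M j i) (hb : ∀ w < 4, b w = 0) (hv4 : 4 ≤ v) (hvn : v ≤ n)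
    {p q r y : ℕ} (hp : 1 ≤ p) (hq : 1 ≤ q) (hr : 1 ≤ r) (hp3 : p ≤ 3) (hq3 : q ≤ 3) (hr3 : r ≤ 3)
    (hpq : p ≠ q) (hpr : p ≠ r) (hqr : q ≠ r) (hy4 : 4 ≤ y) (hyn : y ≤ n) (hyv : y ≠ v) :
    4 * M p q = -b y := by
  have hpm : p ∈ Finset.Icc 1 n := Finset.mem_Icc.2 (by omega)
  have hqm : q ∈ Finset.Icc 1 n := Finset.mem_Icc.2 (by omega)
  have hrm : r ∈ Finset.Icc 1 n := Finset.mem_Icc.2 (by omega)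
  have hym : y ∈ Finset.Icc 1 n := Finset.mem_Icc.2 (by omega)
  obtain ⟨c, hc, hcr, hcy, hcv, hco⟩ := exists_base_coloring hK1 hK2 hpm hqm hrm hym
    (Finset.mem_Icc.2 (by omega) : v ∈ Finset.Icc 1 n) (by simp; omega)
  have := h.second_difference hK1 (hM q p) hpm hqm hpq (by omega) (by omega) hc hcv
    (fun i hi h1 h2 h3 => by
      by_cases hiy : i = y
      · rw [hiy, hcy]; omega
      · exact (hco i hi h1 h2 hiy h3).2)
  rw [Finset.sum_eq_single_of_mem y hym] at this
  · have hcy' : ∀ s t, recolor c p q s t y = 1 := fun s t => by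
      rw [recolor_of_ne c (by omega) (by omega), hcy]
    have h0 : ∀ t, repInd (Finset.Icc 1 n) (recolor c p q t 1) y = 0 := fun t =>
      repInd_eq_zero (z := q) hqm (by omega) (by rw [recolor_right, hcy'])
    have h1 : repInd (Finset.Icc 1 n) (recolor c p q 1 0) y = 0 :=
      repInd_eq_zero (z := p) hpm (by omega) (by rw [recolor_left c hpq, hcy'])
    have h2 : repInd (Finset.Icc 1 n) (recolor c p q 0 0) y = 1 := by
      refine repInd_eq_one fun z hz hzy => ?_
      rw [hcy']
      by_cases hzq : z = q
      · rw [hzq, recolor_right]; omega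
      by_cases hzp : z = p
      · rw [hzp, recolor_left c hpq]; omega
      rw [recolor_of_ne c hzp hzq]
      by_cases hzv : z = v
      · rw [hzv, hcv]; omega
      · exact (hco z hz hzp hzq hzy.ne hzv).1
    rw [h0, h0, h1, h2] at this
    linarith
  · intro w hw hwy
    rcases lt_or_ge w 4 with hw4 | hw4
    · rw [hb w hw4, zero_mul]
    have hw' : ∀ s t, recolor c p q s t w = c w := fun s t =>
      recolor_of_ne c (by omega) (by omega) s t
    have hr' : ∀ s t, recolor c p q s t r = 0 := fun s t => by
      rw [recolor_of_ne c (Ne.symm hpr) (Ne.symm hqr), hcr]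
    by_cases hcw : c w = 0
    · have : ∀ s t, repInd (Finset.Icc 1 n) (recolor c p q s t) w = 0 := fun s t =>
        repInd_eq_zero (z := r) hrm (by omega) (by rw [hr', hw', hcw])
      simp [this]
    · have hcw1 : c w ≠ 1 := by
        by_cases hwv : w = v
        · rw [hwv, hcv]; omega
        · exact (hco w hw (by omega) (by omega) hwy hwv).1
      have key : ∀ s < 2, ∀ t < 2, repInd (Finset.Icc 1 n) (recolor c p q s t) w =
          repInd (Finset.Icc 1 n) (recolor c p q 0 0) w := by
        intro s hs t ht
        unfold repInd
        congr 1
        refine propext (forall_congr' fun z => forall_congr' fun hz => forall_congr' fun _ => ?_)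
        rw [hw', hw']
        by_cases hzq : z = q
        · rw [hzq, recolor_right, recolor_right]; omega
        by_cases hzp : z = p
        · rw [hzp, recolor_left c hpq, recolor_left c hpq]; omega
        rw [recolor_of_ne c hzp hzq, recolor_of_ne c hzp hzq]
      rw [key 0 (by omega) 1 (by omega), key 1 (by omega) 0 (by omega),
        key 1 (by omega) 1 (by omega)]
      ring

/-- Value of a form whose coefficients away from `v` are governed by a single number `β`. -/
theorem formValue_eq (hn : 3 ≤ n) (hM : ∀ i j, M i j = M j i) (hvv : M v v = 0)
    (hb : ∀ w < 4, b w = 0) (hv4 : 4 ≤ v) (hvn : v ≤ n) {β : ℝ}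
    (hM0 : ∀ i ∈ Finset.Icc 1 n, ∀ j ∈ Finset.Icc 1 n, i ≠ v → j ≠ v →
      M i j = if i ≤ 3 ∧ j ≤ 3 ∧ i ≠ j then -β / 4 else 0)
    (hbβ : ∀ w ∈ Finset.Icc 1 n, 4 ≤ w → w ≠ v → b w = β)
    {c : ℕ → ℕ} (hc : IsColoring (Finset.Icc 1 n) K c) :
    formValue (Finset.Icc 1 n) M b c =
      ∑ i ∈ Finset.Icc 1 n, 2 * M i v * sameInd c i v + (b v - β) * repInd (Finset.Icc 1 n) c v
      + (β * K - β * ∑ w ∈ Finset.Icc 1 3, repInd (Finset.Icc 1 n) c w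
        - β / 2 * (sameInd c 1 2 + sameInd c 1 3 + sameInd c 2 3)) := by
  have hvm : v ∈ Finset.Icc 1 n := Finset.mem_Icc.2 (by omega)
  have hsub : Finset.Icc 1 3 ⊆ Finset.Icc 1 n := Finset.Icc_subset_Icc_right hn
  have hsymm : ∀ i j, sameInd c i j = sameInd c j i := fun i j => by simp only [sameInd, eq_comm]
  have h3 : Finset.Icc 1 3 = ({1, 2, 3} : Finset ℕ) := rfl
  have hE : ∑ i ∈ Finset.Icc 1 n, ∑ j ∈ Finset.Icc 1 n, M i j * sameInd c i j =
      ∑ i ∈ Finset.Icc 1 n, 2 * M i v * sameInd c i v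
        - β / 2 * (sameInd c 1 2 + sameInd c 1 3 + sameInd c 2 3) := by
    have h1 : ∀ i ∈ Finset.Icc 1 n, ∀ j ∈ Finset.Icc 1 n, M i j * sameInd c i j =
        (if i = v then M j v * sameInd c j v else 0) + (if j = v then M i v * sameInd c i v else 0)
        + (if i ≤ 3 ∧ j ≤ 3 ∧ i ≠ j then -β / 4 else 0) * sameInd c i j := by
      intro i hi j hj
      by_cases hiv : i = v
      · subst hiv
        have : ¬ i ≤ 3 := by omega
        by_cases hjv : j = i
        · subst hjv; simp [this, hvv]
        · simp [this, hjv, hM i j, hsymm i j]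
      · by_cases hjv : j = v
        · subst hjv
          have : ¬ j ≤ 3 := by omega
          simp [this, hiv]
        · simp [hiv, hjv, hM0 i hi j hj hiv hjv]
    rw [Finset.sum_congr rfl fun i hi => Finset.sum_congr rfl fun j hj => h1 i hi j hj]
    simp only [Finset.sum_add_distrib, Finset.sum_ite_irrel, Finset.sum_ite_eq',
      Finset.sum_const_zero, hvm, if_true]
    have h2 : ∑ i ∈ Finset.Icc 1 n, ∑ j ∈ Finset.Icc 1 n,
        (if i ≤ 3 ∧ j ≤ 3 ∧ i ≠ j then -β / 4 else 0) * sameInd c i j =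
        ∑ i ∈ Finset.Icc 1 3, ∑ j ∈ Finset.Icc 1 3,
        (if i ≤ 3 ∧ j ≤ 3 ∧ i ≠ j then -β / 4 else 0) * sameInd c i j := by
      rw [← Finset.sum_subset hsub]
      · refine Finset.sum_congr rfl fun i _ => (Finset.sum_subset hsub ?_).symm
        intro j hj hj3
        rw [Finset.mem_Icc] at hj hj3
        rw [if_neg (by omega), zero_mul]
      · intro i hi hi3
        refine Finset.sum_eq_zero fun j _ => ?_
        rw [Finset.mem_Icc] at hi hi3
        rw [if_neg (by omega), zero_mul]
    rw [h2, h3]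
    simp [hsymm 2 1, hsymm 3 1, hsymm 3 2]
    simp only [mul_assoc, ← Finset.mul_sum]
    ring
  have hR : ∑ w ∈ Finset.Icc 1 n, b w * repInd (Finset.Icc 1 n) c w =
      (b v - β) * repInd (Finset.Icc 1 n) c v + β * K
        - β * ∑ w ∈ Finset.Icc 1 3, repInd (Finset.Icc 1 n) c w := by
    have h1 : ∀ w ∈ Finset.Icc 1 n, b w * repInd (Finset.Icc 1 n) c w =
        β * repInd (Finset.Icc 1 n) c w
          + (if w = v then (b v - β) * repInd (Finset.Icc 1 n) c v else 0)
          - (if w ≤ 3 then β * repInd (Finset.Icc 1 n) c w else 0) := by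
      intro w hw
      by_cases hwv : w = v
      · subst hwv
        have : ¬ w ≤ 3 := by omega
        simp only [this, if_true, if_false]; ring
      · by_cases hw3 : w ≤ 3
        · simp [hwv, hw3, hb w (by omega)]
        · simp [hwv, hw3, hbβ w hw (by omega) hwv]
    rw [Finset.sum_congr rfl h1, Finset.sum_sub_distrib, Finset.sum_add_distrib, Finset.sum_ite_eq',
      if_pos hvm, ← Finset.mul_sum, sum_repInd hc, ← Finset.sum_subset hsub, Finset.mul_sum]
    · rw [Finset.sum_congr rfl fun w hw => if_pos (Finset.mem_Icc.1 hw).2]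
      ring
    · intro w hw hw3
      rw [Finset.mem_Icc] at hw hw3
      rw [if_neg (by omega)]
  rw [formValue, hE, hR]
  ring

theorem small_separated {c : ℕ → ℕ} (h12 : c 1 ≠ c 2) (h13 : c 1 ≠ c 3)
    (h23 : c 2 ≠ c 3) : ∑ w ∈ Finset.Icc 1 3, repInd (Finset.Icc 1 n) c w = 3 ∧
      sameInd c 1 2 + sameInd c 1 3 + sameInd c 2 3 = 0 := by
  constructor
  · rw [Finset.sum_congr rfl (g := fun _ => (1 : ℝ))]
    · simp
    · intro w hw
      refine repInd_eq_one fun z hz hzw => ?_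
      rw [Finset.mem_Icc] at hw hz
      obtain ⟨rfl, rfl⟩ | ⟨rfl, rfl⟩ | ⟨rfl, rfl⟩ :
        (z = 1 ∧ w = 2) ∨ (z = 1 ∧ w = 3) ∨ (z = 2 ∧ w = 3) := by omega
      all_goals assumption
  · simp [sameInd, *]

theorem small_merged (hn : 3 ≤ n) {c : ℕ → ℕ} {p q r : ℕ} (hp : 1 ≤ p) (hpq : p < q) (hq3 : q ≤ 3)
    (hr : 1 ≤ r) (hr3 : r ≤ 3) (hrp : r ≠ p) (hrq : r ≠ q) (h : c p = c q) (h' : c r ≠ c p) :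
    ∑ w ∈ Finset.Icc 1 3, repInd (Finset.Icc 1 n) c w = 2 ∧
      sameInd c 1 2 + sameInd c 1 3 + sameInd c 2 3 = 1 := by
  have hpm : p ∈ Finset.Icc 1 n := Finset.mem_Icc.2 (by omega)
  have h1 : repInd (Finset.Icc 1 n) c q = 0 := repInd_eq_zero hpm hpq h
  have h2 : repInd (Finset.Icc 1 n) c p = 1 := repInd_eq_one fun z hz hzp => by
    rw [Finset.mem_Icc] at hz
    rwa [show z = r by omega]
  have h3 : repInd (Finset.Icc 1 n) c r = 1 := repInd_eq_one fun z hz hzp => by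
    rw [Finset.mem_Icc] at hz
    rcases (by omega : z = p ∨ z = q) with rfl | rfl
    · exact h'.symm
    · exact fun e => h' (by rw [← e, h])
  have h4 : Finset.Icc 1 3 = ({1, 2, 3} : Finset ℕ) := rfl
  have h'' := h'.symm
  rw [h4]
  obtain ⟨rfl, rfl, rfl⟩ | ⟨rfl, rfl, rfl⟩ | ⟨rfl, rfl, rfl⟩ : (p = 1 ∧ q = 2 ∧ r = 3) ∨
    (p = 1 ∧ q = 3 ∧ r = 2) ∨ (p = 2 ∧ q = 3 ∧ r = 1) := by omega
  all_goals simp_all [sameInd]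
  all_goals norm_num

/-- There are face colorings with the same class of `v`, one of which separates `1, 2, 3`, while
the other merges two of them. -/
theorem exists_separating_and_merging (hK1 : 3 ≤ K) (hK2 : K + 2 ≤ n) (hv4 : 4 ≤ v) (hvn : v ≤ n)
    (hu : 1 ≤ u) (huv : u < v) (hex : 6 ≤ n ∨ u ≤ 3) :
    ∃ (T : Finset ℕ) (c c' : ℕ → ℕ) (p q r : ℕ), (T = {v} ∨ u ∈ T ∧ v ∈ T) ∧
      IsColoring (Finset.Icc 1 n) K c ∧ IsColoring (Finset.Icc 1 n) K c' ∧
      (∀ i ∈ Finset.Icc 1 n, c i = c v ↔ i ∈ T) ∧ (∀ i ∈ Finset.Icc 1 n, c' i = c' v ↔ i ∈ T) ∧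
      c 1 ≠ c 2 ∧ c 1 ≠ c 3 ∧ c 2 ≠ c 3 ∧ 1 ≤ p ∧ p < q ∧ q ≤ 3 ∧ 1 ≤ r ∧ r ≤ 3 ∧ r ≠ p ∧ r ≠ q ∧
      c' p = c' q ∧ c' r ≠ c' p := by
  rcases hK1.lt_or_eq with hK | rfl
  · obtain ⟨s, hs4, hsn, hsv⟩ : ∃ s, 4 ≤ s ∧ s ≤ n ∧ s ≠ v := by
      by_cases h : v = 4
      · exact ⟨5, by omega⟩
      · exact ⟨4, by omega⟩
    obtain ⟨c, h1, h2, h3⟩ := exists_coloring_extension (Finset.Icc 1 n) 0 (K - 4) {1, 2, 3, v} 4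
      (fun i => if i = v then 3 else i - 1) (by
        intro i hi
        simp only [Finset.mem_insert, Finset.mem_singleton] at hi
        rw [Finset.mem_Icc]; omega)
      ⟨by
        intro i hi
        simp only [Finset.mem_insert, Finset.mem_singleton] at hi
        dsimp only; split_ifs <;> omega, by
        intro t ht
        by_cases ht3 : t = 3
        · exact ⟨v, by simp, by simp [ht3]⟩
        · refine ⟨t + 1, ?_, ?_⟩
          · simp only [Finset.mem_insert, Finset.mem_singleton]; omega
          · dsimp only; rw [if_neg (by omega)]; omega⟩ (by omega)
      (by have := Finset.card_le_four (a := 1) (b := 2) (c := 3) (d := v)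
          rw [Nat.card_Icc]; omega)
    obtain ⟨c', h1', h2', h3'⟩ := exists_coloring_extension (Finset.Icc 1 n) 0 (K - 4)
      {1, 2, 3, v, s} 4
      (fun i => if i = v then 3 else if i = s then 2 else i - 2) (by
        intro i hi
        simp only [Finset.mem_insert, Finset.mem_singleton] at hi
        rw [Finset.mem_Icc]; omega)
      ⟨by
        intro i hi
        simp only [Finset.mem_insert, Finset.mem_singleton] at hi
        dsimp only; split_ifs <;> omega, by
        intro t ht
        by_cases ht3 : t = 3
        · exact ⟨v, by simp, by simp [ht3]⟩
        by_cases ht2 : t = 2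
        · exact ⟨s, by simp, by simp [ht2, hsv]⟩
        · refine ⟨t + 2, ?_, ?_⟩
          · simp only [Finset.mem_insert, Finset.mem_singleton]; omega
          · dsimp only; rw [if_neg (by omega), if_neg (by omega)]; omega⟩ (by omega)
      (by have := Finset.card_le_five (a := 1) (b := 2) (c := 3) (d := v) (e := s)
          rw [Nat.card_Icc]; omega)
    rw [Nat.add_sub_cancel' hK] at h1 h1'
    have hcv : c v = 3 := by rw [h2 v (by simp)]; simp
    have hcv' : c' v = 3 := by rw [h2' v (by simp)]; simp
    refine ⟨{v}, c, c', 1, 2, 3, Or.inl rfl, h1, h1', ?_, ?_, ?_, ?_, ?_, by omega, by omega,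
      by omega, by omega, by omega, by omega, by omega, ?_, ?_⟩
    · intro i hi
      rw [Finset.mem_singleton]
      refine ⟨fun h => ?_, fun h => by rw [h]⟩
      by_contra hiv
      by_cases hiS : i ∈ ({1, 2, 3, v} : Finset ℕ)
      · have := h2 i hiS
        simp only [Finset.mem_insert, Finset.mem_singleton] at hiS
        rw [if_neg hiv] at this
        omega
      · have := h3 i hi hiS
        omega
    · intro i hi
      rw [Finset.mem_singleton]
      refine ⟨fun h => ?_, fun h => by rw [h]⟩
      by_contra hiv
      by_cases hiS : i ∈ ({1, 2, 3, v, s} : Finset ℕ)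
      · have := h2' i hiS
        simp only [Finset.mem_insert, Finset.mem_singleton] at hiS
        rw [if_neg hiv] at this
        split_ifs at this <;> omega
      · have := h3' i hi hiS
        omega
    · rw [h2 1 (by simp), h2 2 (by simp)]; split_ifs <;> omega
    · rw [h2 1 (by simp), h2 3 (by simp)]; split_ifs <;> omega
    · rw [h2 2 (by simp), h2 3 (by simp)]; split_ifs <;> omega
    · rw [h2' 1 (by simp), h2' 2 (by simp)]; split_ifs <;> omega
    · rw [h2' 1 (by simp), h2' 3 (by simp)]; split_ifs <;> omega
  · obtain ⟨t, p, q, htu, hp, hpq, hq3, ht, ht3, htp, htq, hup, huq⟩ : ∃ t p q, (u ≤ 3 → t = u) ∧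
        1 ≤ p ∧ p < q ∧ q ≤ 3 ∧ 1 ≤ t ∧ t ≤ 3 ∧ t ≠ p ∧ t ≠ q ∧ u ≠ p ∧ u ≠ q := by
      by_cases h2 : u = 2
      · exact ⟨2, 1, 3, by omega⟩
      by_cases h3 : u = 3
      · exact ⟨3, 1, 2, by omega⟩
      · exact ⟨1, 2, 3, by omega⟩
    obtain ⟨s, hs4, hsn, hsv, hsu⟩ : ∃ s, 4 ≤ s ∧ s ≤ n ∧ s ≠ v ∧ s ≠ u := by
      by_cases h4 : 4 ≠ v ∧ 4 ≠ u
      · exact ⟨4, by omega⟩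
      by_cases h5 : 5 ≠ v ∧ 5 ≠ u
      · exact ⟨5, by omega⟩
      · exact ⟨6, by omega⟩
    have hcol : ∀ a e, 1 ≤ a → a ≤ n → 1 ≤ e → e ≤ n → a ≠ u → a ≠ v → a ≠ t → e ≠ u → e ≠ v →
        e ≠ t → a ≠ e →
        IsColoring (Finset.Icc 1 n) 3 (fun i => if i = u ∨ i = v ∨ i = t then 0 else
          if i = e then 2 else 1) := by
      intro a e _ _ _ _ _ _ _ _ _ _ _
      refine ⟨fun i _ => by dsimp only; split_ifs <;> omega, fun r hr => ?_⟩
      interval_cases r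
      · exact ⟨u, Finset.mem_Icc.2 (by omega), by simp⟩
      · exact ⟨a, Finset.mem_Icc.2 (by omega), by simp [*]⟩
      · exact ⟨e, Finset.mem_Icc.2 (by omega), by simp [*]⟩
    have hcl : ∀ e, ∀ i ∈ Finset.Icc 1 n, (fun i => if i = u ∨ i = v ∨ i = t then 0 else
          if i = e then 2 else 1) i = (fun i => if i = u ∨ i = v ∨ i = t then 0 else
          if i = e then 2 else 1) v ↔ i ∈ ({u, v, t} : Finset ℕ) := by
      intro e i _
      simp only [Finset.mem_insert, Finset.mem_singleton, true_or, or_true, if_true]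
      split_ifs <;> simp_all
    refine ⟨{u, v, t}, _, _, p, q, t, by simp, hcol p q (by omega) (by omega) (by omega) (by omega)
      (by omega) (by omega) (by omega) (by omega) (by omega) (by omega) (by omega),
      hcol p s (by omega) (by omega) (by omega) (by omega)
      (by omega) (by omega) (by omega) (by omega) (by omega) (by omega) (by omega), hcl q, hcl s,
      ?_, ?_, ?_, hp, hpq, hq3, ht, ht3, htp, htq, ?_, ?_⟩
    all_goals split_ifs <;> omega

theorem exists_coloring_with_class (hK1 : 3 ≤ K) (hK2 : K + 2 ≤ n) {T : Finset ℕ}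
    (hT : T ⊆ Finset.Icc 1 n) (hvT : v ∈ T) (hT3 : T.card ≤ 3) :
    ∃ c, IsColoring (Finset.Icc 1 n) K c ∧ ∀ i ∈ Finset.Icc 1 n, c i = c v ↔ i ∈ T := by
  have hV : (Finset.Icc 1 n).card = n := by simp
  obtain ⟨x, hx, hxT⟩ : ∃ x ∈ Finset.Icc 1 n, x ∉ T :=
    Finset.exists_mem_notMem_of_card_lt_card (by omega)
  obtain ⟨c, h1, h2, h3⟩ := exists_coloring_extension (Finset.Icc 1 n) 1 (K - 2) (insert x T) 2
    (fun i => if i ∈ T then 0 else 1) (Finset.insert_subset hx hT)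
    ⟨fun i _ => by dsimp only; split_ifs <;> omega, by
      intro t ht
      interval_cases t
      · exact ⟨v, Finset.mem_insert_of_mem hvT, by simp [hvT]⟩
      · exact ⟨x, Finset.mem_insert_self x T, by simp [hxT]⟩⟩ (by omega)
    (by rw [Finset.card_insert_of_notMem hxT]; omega)
  rw [Nat.add_sub_cancel' (by omega)] at h1
  refine ⟨c, h1, fun i hi => ?_⟩
  rw [h2 v (Finset.mem_insert_of_mem hvT), if_pos hvT]
  by_cases hiT : i ∈ T
  · simp [hiT, h2 i (Finset.mem_insert_of_mem hiT)]
  · by_cases hix : i = x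
    · simp [hix, hxT, h2 x (Finset.mem_insert_self x T)]
    · have := h3 i hi (by simp [hix, hiT])
      simp only [hiT, iff_false]
      omega

/-- A form that is constant on the face is a multiple of `x_{u,v} + x_v`. -/
theorem ConstOnFace.coefficients (h : ConstOnFace n K u v M b κ) (hK1 : 3 ≤ K) (hK2 : K + 2 ≤ n)
    (hM : ∀ i j, M i j = M j i) (hM0 : ∀ i, M i i = 0) (hb : ∀ w < 4, b w = 0) (hv4 : 4 ≤ v)
    (hvn : v ≤ n) (hu : 1 ≤ u) (huv : u < v) (hex : 6 ≤ n ∨ u ≤ 3) :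
    (∀ i ∈ Finset.Icc 1 n, ∀ j ∈ Finset.Icc 1 n,
      M i j = if i = u ∧ j = v ∨ i = v ∧ j = u then κ / 2 else 0) ∧
    ∀ w ∈ Finset.Icc 1 n, b w = if w = v then κ else 0 := by
  obtain ⟨y, hy4, hyn, hyv⟩ : ∃ y, 4 ≤ y ∧ y ≤ n ∧ y ≠ v := by
    by_cases h : v = 4
    · exact ⟨5, by omega⟩
    · exact ⟨4, by omega⟩
  have hsmall : ∀ p q, 1 ≤ p → 1 ≤ q → p ≤ 3 → q ≤ 3 → p ≠ q → ∀ y', 4 ≤ y' → y' ≤ n → y' ≠ v →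
      4 * M p q = -b y' := fun p q hp hq hp3 hq3 hpq y' h1 h2 h3 =>
    h.coeff_small (r := 6 - p - q) hK1 hK2 hM hb hv4 hvn hp hq (by omega) hp3 hq3 (by omega) hpq
      (by omega) (by omega) h1 h2 h3
  have hbβ : ∀ w ∈ Finset.Icc 1 n, 4 ≤ w → w ≠ v → b w = b y := by
    intro w hw hw4 hwv
    have h1 := hsmall 1 2 (by omega) (by omega) (by omega) (by omega) (by omega) w hw4
      (Finset.mem_Icc.1 hw).2 hwv
    have h2 := hsmall 1 2 (by omega) (by omega) (by omega) (by omega) (by omega) y hy4 hyn hyv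
    linarith
  have hMβ : ∀ i ∈ Finset.Icc 1 n, ∀ j ∈ Finset.Icc 1 n, i ≠ v → j ≠ v →
      M i j = if i ≤ 3 ∧ j ≤ 3 ∧ i ≠ j then -b y / 4 else 0 := by
    intro i hi j hj hiv hjv
    rw [Finset.mem_Icc] at hi hj
    split_ifs with hij
    · have := hsmall i j hi.1 hj.1 hij.1 hij.2.1 hij.2.2 y hy4 hyn hyv
      linarith
    · rcases lt_trichotomy i j with hlt | rfl | hlt
      · exact h.coeff_eq_zero hK1 hK2 hM hv4 hvn hi.1 hlt hj.2 (by omega) hiv hjv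
      · exact hM0 i
      · rw [hM]
        exact h.coeff_eq_zero hK1 hK2 hM hv4 hvn hj.1 hlt hi.2 (by omega) hjv hiv
  have hval := fun {c : ℕ → ℕ} (hc : IsColoring (Finset.Icc 1 n) K c) =>
    formValue_eq (by omega) hM (hM0 v) hb hv4 hvn hMβ hbβ hc
  have hvm : v ∈ Finset.Icc 1 n := Finset.mem_Icc.2 (by omega)
  have hum : u ∈ Finset.Icc 1 n := Finset.mem_Icc.2 (by omega)
  have hrepT : ∀ {T : Finset ℕ} {c : ℕ → ℕ}, (∀ i ∈ Finset.Icc 1 n, c i = c v ↔ i ∈ T) →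
      (T = {v} ∨ u ∈ T ∧ v ∈ T) →
      repInd (Finset.Icc 1 n) c v = if u ∈ T then 0 else 1 := by
    rintro T c hT (rfl | hTT)
    · rw [if_neg (by simpa using huv.ne)]
      refine repInd_eq_one fun z hz hzv => ?_
      rw [Ne, hT z hz, Finset.mem_singleton]
      omega
    · rw [if_pos hTT.1, repInd_eq_zero hum huv ((hT u hum).2 hTT.1)]
  have hsameT : ∀ {T : Finset ℕ} {c : ℕ → ℕ}, (∀ i ∈ Finset.Icc 1 n, c i = c v ↔ i ∈ T) →
      ∀ i ∈ Finset.Icc 1 n, sameInd c i v = if i ∈ T then 1 else 0 := by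
    intro T c hT i hi
    simp only [sameInd, hT i hi]
  have hface : ∀ {T : Finset ℕ} {c : ℕ → ℕ}, (∀ i ∈ Finset.Icc 1 n, c i = c v ↔ i ∈ T) →
      (T = {v} ∨ u ∈ T ∧ v ∈ T) → IsColoring (Finset.Icc 1 n) K c →
      formValue (Finset.Icc 1 n) M b c = κ := by
    intro T c hT hTT hc
    refine h c hc ?_
    rcases hTT with rfl | hTT
    · refine Or.inr fun z hz hzv => ?_
      rw [Ne, hT z hz, Finset.mem_singleton]
      omega
    · exact Or.inl ((hT u hum).2 hTT.1)
  have hβ : b y = 0 := by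
    obtain ⟨T, c, c', p, q, r, hTT, hc, hc', hT, hT', h12, h13, h23, hp, hpq, hq3, hr, hr3, hrp,
      hrq, hm1, hm2⟩ := exists_separating_and_merging hK1 hK2 hv4 hvn hu huv hex
    have e := hval hc
    have e' := hval hc'
    obtain ⟨e1, e2⟩ := small_separated (n := n) h12 h13 h23
    obtain ⟨e3, e4⟩ := small_merged (n := n) (by omega) hp hpq hq3 hr hr3 hrp hrq hm1 hm2
    rw [hface hT hTT hc, hrepT hT hTT, e1, e2,
      Finset.sum_congr rfl fun i hi => by rw [hsameT hT i hi]] at e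
    rw [hface hT' hTT hc', hrepT hT' hTT, e3, e4,
      Finset.sum_congr rfl fun i hi => by rw [hsameT hT' i hi]] at e'
    linarith
  have hvalT : ∀ T : Finset ℕ, T ⊆ Finset.Icc 1 n → v ∈ T → T.card ≤ 3 →
      (T = {v} ∨ u ∈ T ∧ v ∈ T) →
      κ = ∑ i ∈ T, 2 * M i v + b v * if u ∈ T then 0 else 1 := by
    intro T hTV hvT hT3 hTT
    obtain ⟨c, hc, hT⟩ := exists_coloring_with_class hK1 hK2 hTV hvT hT3
    rw [← hface hT hTT hc, hval hc, hβ, hrepT hT hTT,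
      Finset.sum_congr rfl fun i hi => by rw [hsameT hT i hi], ← Finset.sum_subset hTV]
    · rw [Finset.sum_congr rfl fun i hi => by rw [if_pos hi, mul_one]]
      ring
    · intro i _ hi
      rw [if_neg hi, mul_zero]
  have hbv : b v = κ := by
    have := hvalT {v} (by simpa using hvm) (by simp) (by simp) (Or.inl rfl)
    rw [if_neg (by simpa using huv.ne), Finset.sum_singleton,
      hM0] at this
    linarith
  have hdu : 2 * M u v = κ := by
    have := hvalT {u, v} (Finset.insert_subset hum (by simpa using hvm)) (by simp)
      (Finset.card_le_two.trans (by omega)) (Or.inr (by simp))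
    rw [if_pos (by simp), Finset.sum_pair huv.ne, hM0] at this
    linarith
  have hdp : ∀ p ∈ Finset.Icc 1 n, p ≠ u → M p v = 0 := by
    intro p hp hpu
    by_cases hpv : p = v
    · rw [hpv, hM0]
    have := hvalT {p, u, v}
      (Finset.insert_subset hp (Finset.insert_subset hum (by simpa using hvm)))
      (by simp) Finset.card_le_three (Or.inr (by simp))
    rw [if_pos (by simp), Finset.sum_insert (by simp [hpu, hpv]),
      Finset.sum_pair huv.ne, hM0] at this
    linarith
  constructor
  · intro i hi j hj
    by_cases hjv : j = v
    · subst hjv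
      by_cases hiu : i = u
      · subst hiu; simp; linarith
      · rw [hdp i hi hiu, if_neg (by omega)]
    by_cases hiv : i = v
    · subst hiv
      rw [hM]
      by_cases hju : j = u
      · subst hju; simp; linarith
      · rw [hdp j hj hju, if_neg (by omega)]
    rw [hMβ i hi j hj hiv hjv, hβ, if_neg (c := i = u ∧ j = v ∨ i = v ∧ j = u) (by omega)]
    simp
  · intro w hw
    split_ifs with hwv
    · rw [hwv, hbv]
    · rcases lt_or_ge w 4 with hw4 | hw4
      · exact hb w hw4
      · rw [hbβ w hw hw4 hwv, hβ]

end FaceForm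

/-- Characteristic vector of the partition of `{1,…,n}` into the classes of `c`. -/
def colorVec (n : ℕ) (c : ℕ → ℕ) : GPoint :=
  ⟨fun p => if p.1 ∈ Finset.Icc 1 n ∧ p.2 ∈ Finset.Icc 1 n then sameInd c p.1 p.2 else 0,
   fun w => if w ∈ Finset.Icc 1 n ∧ 4 ≤ w then repInd (Finset.Icc 1 n) c w else 0⟩

theorem KPartition.mem_iff {n K : ℕ} (π : KPartition n K) {i : ℕ} :
    i ∈ Finset.Icc 1 n ↔ ∃ C ∈ π.parts, i ∈ C := by
  rw [← π.parts_cover, Finset.mem_sup]; rfl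

theorem KPartition.eq_of_mem {n K : ℕ} (π : KPartition n K) {C D : Finset ℕ} {i : ℕ}
    (hC : C ∈ π.parts) (hD : D ∈ π.parts) (hiC : i ∈ C) (hiD : i ∈ D) : C = D := by
  by_contra h
  exact Finset.disjoint_left.1 (π.parts_disjoint C hC D hD h) hiC hiD

theorem charVec_eq_colorVec {n K : ℕ} (π : KPartition n K) (c : ℕ → ℕ)
    (h : ∀ i ∈ Finset.Icc 1 n, ∀ j ∈ Finset.Icc 1 n,
      (∃ C ∈ π.parts, i ∈ C ∧ j ∈ C) ↔ c i = c j) : charVec n K π = colorVec n c := by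
  unfold charVec colorVec
  congr 1
  · funext p
    by_cases hp : p.1 ∈ Finset.Icc 1 n ∧ p.2 ∈ Finset.Icc 1 n
    · rw [if_pos hp, sameInd]
      exact if_congr (h _ hp.1 _ hp.2) rfl rfl
    · rw [if_neg hp, if_neg]
      rintro ⟨C, hC, h1, h2⟩
      exact hp ⟨π.mem_iff.2 ⟨C, hC, h1⟩, π.mem_iff.2 ⟨C, hC, h2⟩⟩
  · funext w
    by_cases hw : w ∈ Finset.Icc 1 n ∧ 4 ≤ w
    · rw [if_pos hw, repInd]
      refine if_congr ⟨?_, ?_⟩ rfl rfl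
      · rintro ⟨_, C, hC, hwC, hmin⟩ z hz hzw hcz
        obtain ⟨D, hD, hzD, hwD⟩ := (h z hz w hw.1).2 hcz
        rw [π.eq_of_mem hD hC hwD hwC] at hzD
        exact absurd (hmin z hzD) (by omega)
      · intro hrep
        obtain ⟨C, hC, hwC⟩ := π.mem_iff.1 hw.1
        refine ⟨hw.2, C, hC, hwC, fun z hz => ?_⟩
        by_contra hzw
        have hzm := π.mem_iff.2 ⟨C, hC, hz⟩
        exact hrep z hzm (by omega) ((h z hzm w hw.1).1 ⟨C, hC, hz, hwC⟩)
    · rw [if_neg hw, if_neg]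
      rintro ⟨h4, C, hC, hwC, _⟩
      exact hw ⟨π.mem_iff.2 ⟨C, hC, hwC⟩, h4⟩

theorem KPartition.exists_coloring {n K : ℕ} (π : KPartition n K) :
    ∃ c, IsColoring (Finset.Icc 1 n) K c ∧ charVec n K π = colorVec n c := by
  have hex : ∀ i, ∃ t, ∀ hi : i ∈ Finset.Icc 1 n, ∃ h : t < K,
      i ∈ ((π.parts.equivFinOfCardEq π.card_parts).symm ⟨t, h⟩).1 := by
    intro i
    by_cases hi : i ∈ Finset.Icc 1 n
    · obtain ⟨C, hC, hiC⟩ := π.mem_iff.1 hi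
      exact ⟨π.parts.equivFinOfCardEq π.card_parts ⟨C, hC⟩, fun _ => ⟨Fin.is_lt _, by simpa⟩⟩
    · exact ⟨0, fun h => absurd h hi⟩
  choose c hc using hex
  refine ⟨c, ⟨fun i hi => (hc i hi).1, fun t ht => ?_⟩, charVec_eq_colorVec π c ?_⟩
  · set C := (π.parts.equivFinOfCardEq π.card_parts).symm ⟨t, ht⟩ with hC
    obtain ⟨i, hi⟩ := π.parts_nonempty C.1 C.2
    have him := π.mem_iff.2 ⟨C.1, C.2, hi⟩
    refine ⟨i, him, ?_⟩
    obtain ⟨h1, h2⟩ := hc i him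
    have := Subtype.ext (π.eq_of_mem (Subtype.prop _) C.2 h2 hi)
    rw [hC, Equiv.apply_eq_iff_eq] at this
    exact congrArg Fin.val this
  · intro i hi j hj
    obtain ⟨h1, h2⟩ := hc i hi
    obtain ⟨h3, h4⟩ := hc j hj
    constructor
    · rintro ⟨C, hC, hiC, hjC⟩
      have := Subtype.ext ((π.eq_of_mem (Subtype.prop _) hC h2 hiC).trans
        (π.eq_of_mem (Subtype.prop _) hC h4 hjC).symm)
      rw [Equiv.apply_eq_iff_eq] at this
      exact congrArg Fin.val this
    · intro hij
      refine ⟨_, Subtype.prop _, h2, ?_⟩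
      simpa only [hij] using h4

theorem IsColoring.exists_kPartition {n K : ℕ} {c : ℕ → ℕ}
    (hc : IsColoring (Finset.Icc 1 n) K c) :
    ∃ π : KPartition n K, charVec n K π = colorVec n c := by
  have hmem : ∀ {C}, C ∈ (Finset.range K).image (fun t => (Finset.Icc 1 n).filter (c · = t)) ↔
      ∃ t < K, (Finset.Icc 1 n).filter (c · = t) = C := by simp
  refine ⟨⟨(Finset.range K).image fun t => (Finset.Icc 1 n).filter (c · = t), ?_, ?_, ?_, ?_⟩,
    charVec_eq_colorVec _ c ?_⟩
  · rw [Finset.card_image_of_injOn, Finset.card_range]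
    intro s hs t _ hst
    obtain ⟨i, hi, his⟩ := hc.2 s (Finset.mem_range.1 hs)
    have : i ∈ (Finset.Icc 1 n).filter (c · = t) := by
      beta_reduce at hst
      rw [← hst]; exact Finset.mem_filter.2 ⟨hi, his⟩
    rw [← his, (Finset.mem_filter.1 this).2]
  · intro C hC
    obtain ⟨t, ht, rfl⟩ := hmem.1 hC
    obtain ⟨i, hi, hit⟩ := hc.2 t ht
    exact ⟨i, Finset.mem_filter.2 ⟨hi, hit⟩⟩
  · intro C hC D hD hne
    obtain ⟨s, _, rfl⟩ := hmem.1 hC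
    obtain ⟨t, _, rfl⟩ := hmem.1 hD
    rw [Finset.disjoint_left]
    intro i hi hi'
    rw [Finset.mem_filter] at hi hi'
    exact hne (by rw [← hi.2, ← hi'.2])
  · ext i
    simp only [Finset.mem_sup, hmem, id]
    constructor
    · rintro ⟨_, ⟨t, _, rfl⟩, hi⟩
      exact (Finset.mem_filter.1 hi).1
    · intro hi
      exact ⟨_, ⟨c i, hc.1 i hi, rfl⟩, Finset.mem_filter.2 ⟨hi, rfl⟩⟩
  · intro i hi j hj
    simp only [hmem]
    constructor
    · rintro ⟨_, ⟨t, _, rfl⟩, hit, hjt⟩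
      rw [(Finset.mem_filter.1 hit).2, (Finset.mem_filter.1 hjt).2]
    · intro hij
      exact ⟨_, ⟨c i, hc.1 i hi, rfl⟩, Finset.mem_filter.2 ⟨hi, rfl⟩,
        Finset.mem_filter.2 ⟨hj, hij.symm⟩⟩

/-- The vertex set of the polytope, in terms of colorings. -/
def colorVecs (n K : ℕ) : Set GPoint :=
  {x | ∃ c, IsColoring (Finset.Icc 1 n) K c ∧ x = colorVec n c}

theorem setOf_charVec_eq (n K : ℕ) :
    {x | ∃ π : KPartition n K, x = charVec n K π} = colorVecs n K := by
  ext x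
  constructor
  · rintro ⟨π, rfl⟩
    exact π.exists_coloring
  · rintro ⟨c, hc, rfl⟩
    obtain ⟨π, hπ⟩ := hc.exists_kPartition
    exact ⟨π, hπ.symm⟩

theorem finite_colorVecs (n K : ℕ) : (colorVecs n K).Finite := by
  have : Finite (KPartition n K) := by
    refine Finite.of_injective (β := ↥(Finset.Icc 1 n).powerset.powerset)
      (fun π => ⟨π.parts, Finset.mem_powerset.2 fun C hC => Finset.mem_powerset.2 fun i hi =>
        π.mem_iff.2 ⟨C, hC, hi⟩⟩) ?_
    rintro ⟨p, _, _, _, _⟩ ⟨q, _, _, _, _⟩ h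
    simpa using h
  rw [← setOf_charVec_eq]
  refine (Set.finite_range (charVec n K)).subset ?_
  rintro _ ⟨π, rfl⟩
  exact ⟨π, rfl⟩

/-- The edge coefficients of a linear form, symmetrized. -/
noncomputable def edgeCoeff (φ : GPoint →ₗ[ℝ] ℝ) (i j : ℕ) : ℝ :=
  if i = j then 0 else (φ (Pi.single (i, j) 1, 0) + φ (Pi.single (j, i) 1, 0)) / 2

/-- The representative coefficients of a linear form. -/
noncomputable def repCoeff (φ : GPoint →ₗ[ℝ] ℝ) (w : ℕ) : ℝ :=
  if 4 ≤ w then φ (0, Pi.single w 1) else 0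

theorem linearMap_colorVec (φ : GPoint →ₗ[ℝ] ℝ) (n : ℕ) (c : ℕ → ℕ) :
    φ (colorVec n c) = formValue (Finset.Icc 1 n) (edgeCoeff φ) (repCoeff φ) c
      + ∑ i ∈ Finset.Icc 1 n, φ (Pi.single (i, i) 1, 0) := by
  have hdec : colorVec n c =
      ∑ i ∈ Finset.Icc 1 n, ∑ j ∈ Finset.Icc 1 n,
        sameInd c i j • ((Pi.single (i, j) 1, 0) : GPoint)
      + ∑ w ∈ Finset.Icc 1 n, (if 4 ≤ w then repInd (Finset.Icc 1 n) c w else 0) •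
        ((0, Pi.single w 1) : GPoint) := by
    refine Prod.ext (funext fun p => ?_) (funext fun w => ?_)
    · obtain ⟨i, j⟩ := p
      simp only [colorVec, Prod.fst_add, Prod.fst_sum, Prod.smul_fst, Pi.add_apply,
        Finset.sum_apply, Pi.smul_apply, Pi.single_apply, Prod.mk.injEq, smul_eq_mul, smul_zero,
        Finset.sum_const_zero, add_zero, Pi.zero_apply, mul_ite, mul_one, mul_zero, ite_and,
        Finset.sum_ite_irrel, Finset.sum_ite_eq]
    · simp only [colorVec, Prod.snd_add, Prod.snd_sum, Prod.smul_snd, Pi.add_apply,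
        Finset.sum_apply, Pi.smul_apply, Pi.single_apply, smul_eq_mul, smul_zero,
        Finset.sum_const_zero, zero_add, Pi.zero_apply, mul_ite, mul_one, mul_zero, ite_and,
        Finset.sum_ite_eq]
  have hdiag : ∀ i ∈ Finset.Icc 1 n, φ (Pi.single (i, i) 1, 0) =
      ∑ j ∈ Finset.Icc 1 n, if i = j then φ (Pi.single (i, i) 1, 0) else 0 := fun i hi => by
    rw [Finset.sum_ite_eq, if_pos hi]
  have hedge : ∑ i ∈ Finset.Icc 1 n, ∑ j ∈ Finset.Icc 1 n,
      sameInd c i j * φ (Pi.single (i, j) 1, 0) =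
      ∑ i ∈ Finset.Icc 1 n, ∑ j ∈ Finset.Icc 1 n, edgeCoeff φ i j * sameInd c i j
      + ∑ i ∈ Finset.Icc 1 n, φ (Pi.single (i, i) 1, 0) := by
    have hcomm : ∑ i ∈ Finset.Icc 1 n, ∑ j ∈ Finset.Icc 1 n,
        sameInd c i j * φ (Pi.single (i, j) 1, 0) =
        ∑ i ∈ Finset.Icc 1 n, ∑ j ∈ Finset.Icc 1 n, sameInd c i j * φ (Pi.single (j, i) 1, 0) := by
      rw [Finset.sum_comm]
      simp only [sameInd, eq_comm]
    have hsum : ∀ i j, edgeCoeff φ i j * sameInd c i j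
        + (if i = j then φ (Pi.single (i, i) 1, 0) else 0) =
        (sameInd c i j * φ (Pi.single (i, j) 1, 0)
          + sameInd c i j * φ (Pi.single (j, i) 1, 0)) / 2 := by
      intro i j
      by_cases hij : i = j
      · subst hij; simp [edgeCoeff, sameInd]
      · simp only [edgeCoeff, if_neg hij]; ring
    rw [Finset.sum_congr rfl hdiag]
    simp only [← Finset.sum_add_distrib, hsum, ← Finset.sum_div]
    simp only [Finset.sum_add_distrib]
    rw [← hcomm]
    ring
  rw [hdec]
  simp only [map_add, map_sum, map_smul, smul_eq_mul]
  rw [hedge, formValue, add_right_comm]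
  congr 2
  refine Finset.sum_congr rfl fun w _ => ?_
  unfold repCoeff
  split_ifs <;> ring

/-- Facets of the convex hull of a finite set, in terms of directions. -/
theorem adim_face_add_one_iff {S : Set GPoint} (hS : S.Finite) (f : GPoint →ₗ[ℝ] ℝ) {b : ℝ}
    {s₀ s₁ : GPoint} (h₀ : s₀ ∈ S) (h₁ : s₁ ∈ S) (hf₀ : f s₀ ≠ b) (hf₁ : f s₁ = b) :
    adim {x | x ∈ convexHull ℝ S ∧ f x = b} + 1 = adim (convexHull ℝ S) ↔
      vectorSpan ℝ {x | x ∈ convexHull ℝ S ∧ f x = b} = vectorSpan ℝ S ⊓ LinearMap.ker f := by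
  have hfin : FiniteDimensional ℝ (vectorSpan ℝ S) := finiteDimensional_vectorSpan_of_finite ℝ hS
  have hspan : vectorSpan ℝ (convexHull ℝ S) = vectorSpan ℝ S := by
    rw [← direction_affineSpan, affineSpan_convexHull, direction_affineSpan]
  have hle : vectorSpan ℝ {x | x ∈ convexHull ℝ S ∧ f x = b} ≤
      vectorSpan ℝ S ⊓ LinearMap.ker f := by
    refine le_inf ((vectorSpan_mono ℝ fun x hx => hx.1).trans hspan.le) ?_
    rw [vectorSpan_def, Submodule.span_le]
    rintro _ ⟨x, hx, y, hy, rfl⟩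
    simp [hx.2, hy.2]
  have hrank : Module.finrank ℝ ↥(vectorSpan ℝ S ⊓ LinearMap.ker f) + 1 =
      Module.finrank ℝ (vectorSpan ℝ S) := by
    have hsurj : Function.Surjective (f.domRestrict (vectorSpan ℝ S)) := by
      refine LinearMap.surjective fun h => ?_
      have := LinearMap.congr_fun h ⟨s₀ -ᵥ s₁, vsub_mem_vectorSpan ℝ h₀ h₁⟩
      simp only [LinearMap.domRestrict_apply, vsub_eq_sub, map_sub, LinearMap.zero_apply] at this
      exact hf₀ (by linarith)
    have h := LinearMap.finrank_range_add_finrank_ker (f.domRestrict (vectorSpan ℝ S))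
    rw [LinearMap.range_eq_top.2 hsurj, finrank_top, Module.finrank_self, LinearMap.ker_domRestrict]
      at h
    rw [← h, add_comm, ← Submodule.map_comap_subtype, add_right_inj]
    exact (LinearEquiv.finrank_eq (Submodule.equivSubtypeMap (vectorSpan ℝ S)
      ((LinearMap.ker f).comap (vectorSpan ℝ S).subtype))).symm
  rw [adim, adim, direction_affineSpan, direction_affineSpan, hspan, ← hrank, add_left_inj]
  constructor
  · intro h
    have : FiniteDimensional ℝ ↥(vectorSpan ℝ S ⊓ LinearMap.ker f) :=
      Submodule.finiteDimensional_of_le inf_le_left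
    exact Submodule.eq_of_le_of_finrank_eq hle h
  · intro h
    rw [h]

/-- The left-hand side of the upper representative inequality. -/
def upperForm (u v : ℕ) : GPoint →ₗ[ℝ] ℝ where
  toFun x := x.1 (u, v) + x.2 v
  map_add' x y := by simp only [Prod.fst_add, Prod.snd_add, Pi.add_apply]; ring
  map_smul' r x := by
    simp only [Prod.smul_fst, Prod.smul_snd, Pi.smul_apply, smul_eq_mul, RingHom.id_apply]; ring

theorem upperForm_colorVec {n u v : ℕ} (hv4 : 4 ≤ v) (hvn : v ≤ n) (hu : 1 ≤ u) (huv : u < v)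
    (c : ℕ → ℕ) :
    upperForm u v (colorVec n c) = sameInd c u v + repInd (Finset.Icc 1 n) c v := by
  have hvm : v ∈ Finset.Icc 1 n := Finset.mem_Icc.2 (by omega)
  have hum : u ∈ Finset.Icc 1 n := Finset.mem_Icc.2 (by omega)
  change (if u ∈ Finset.Icc 1 n ∧ v ∈ Finset.Icc 1 n then sameInd c u v else 0) +
    (if v ∈ Finset.Icc 1 n ∧ 4 ≤ v then repInd (Finset.Icc 1 n) c v else 0) = _
  rw [if_pos ⟨hum, hvm⟩, if_pos ⟨hvm, hv4⟩]

theorem upperForm_eq_one {n u v : ℕ} (hv4 : 4 ≤ v) (hvn : v ≤ n) (hu : 1 ≤ u) (huv : u < v)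
    {c : ℕ → ℕ} (h : c u = c v ∨ ∀ z ∈ Finset.Icc 1 n, z < v → c z ≠ c v) :
    upperForm u v (colorVec n c) = 1 := by
  have hum : u ∈ Finset.Icc 1 n := Finset.mem_Icc.2 (by omega)
  rw [upperForm_colorVec hv4 hvn hu huv]
  rcases h with h | h
  · rw [repInd_eq_zero hum huv h, sameInd, if_pos h, add_zero]
  · rw [repInd_eq_one h, sameInd, if_neg (h u hum huv), zero_add]

theorem upperForm_eq_zero {n u v p : ℕ} (hv4 : 4 ≤ v) (hvn : v ≤ n) (hu : 1 ≤ u) (huv : u < v)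
    {c : ℕ → ℕ} (h : c u ≠ c v) (hp : p ∈ Finset.Icc 1 n) (hpv : p < v) (hcp : c p = c v) :
    upperForm u v (colorVec n c) = 0 := by
  rw [upperForm_colorVec hv4 hvn hu huv, repInd_eq_zero hp hpv hcp, sameInd, if_neg h, add_zero]

theorem upperForm_le_one {n K u v : ℕ} (hv4 : 4 ≤ v) (hvn : v ≤ n) (hu : 1 ≤ u) (huv : u < v) :
    ∀ x ∈ convexHull ℝ (colorVecs n K), upperForm u v x ≤ 1 := by
  refine convexHull_min (t := {x | upperForm u v x ≤ 1}) ?_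
    (convex_halfSpace_le (upperForm u v).isLinear 1)
  rintro _ ⟨c, _, rfl⟩
  rw [Set.mem_ofPred_eq]
  by_cases h : c u = c v ∨ ∀ z ∈ Finset.Icc 1 n, z < v → c z ≠ c v
  · exact (upperForm_eq_one hv4 hvn hu huv h).le
  · push Not at h
    obtain ⟨h1, z, hz, hzv, hcz⟩ := h
    rw [upperForm_eq_zero hv4 hvn hu huv h1 hz hzv hcz]
    exact zero_le_one

/-- The direction of the face cut out by the upper representative inequality. -/
theorem vectorSpan_face_eq {n K u v : ℕ} (hK1 : 3 ≤ K) (hK2 : K + 2 ≤ n) (hv4 : 4 ≤ v)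
    (hvn : v ≤ n) (hu : 1 ≤ u) (huv : u < v) (hex : 6 ≤ n ∨ u ≤ 3) :
    vectorSpan ℝ {x | x ∈ convexHull ℝ (colorVecs n K) ∧ upperForm u v x = 1} =
      vectorSpan ℝ (colorVecs n K) ⊓ LinearMap.ker (upperForm u v) := by
  have hvm : v ∈ Finset.Icc 1 n := Finset.mem_Icc.2 (by omega)
  have hum : u ∈ Finset.Icc 1 n := Finset.mem_Icc.2 (by omega)
  set F := {x | x ∈ convexHull ℝ (colorVecs n K) ∧ upperForm u v x = 1} with hF
  have hmemF : ∀ {c}, IsColoring (Finset.Icc 1 n) K c →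
      (c u = c v ∨ ∀ z ∈ Finset.Icc 1 n, z < v → c z ≠ c v) → colorVec n c ∈ F := fun hc h =>
    ⟨subset_convexHull ℝ _ ⟨_, hc, rfl⟩, upperForm_eq_one hv4 hvn hu huv h⟩
  apply le_antisymm
  · refine le_inf ?_ ?_
    · rw [← direction_affineSpan ℝ (colorVecs n K), ← affineSpan_convexHull, direction_affineSpan]
      exact vectorSpan_mono ℝ fun x hx => hx.1
    · rw [vectorSpan_def, Submodule.span_le]
      rintro _ ⟨x, hx, y, hy, rfl⟩
      simp [hx.2, hy.2]
  · rintro x ⟨hx, hfx⟩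
    by_contra hxF
    obtain ⟨φ, hφx, hφF⟩ := Submodule.exists_le_ker_of_notMem hxF
    obtain ⟨c₁, hc₁, hT⟩ := exists_coloring_with_class (T := {v}) hK1 hK2 (by simpa using hvm)
      (Finset.mem_singleton_self v) (by simp)
    have hc₁F : colorVec n c₁ ∈ F := hmemF hc₁ (Or.inr fun z hz hzv => by
      rw [Ne, hT z hz, Finset.mem_singleton]; omega)
    set δ := ∑ i ∈ Finset.Icc 1 n, φ (Pi.single (i, i) 1, 0) with hδ
    have hconst : ConstOnFace n K u v (edgeCoeff φ) (repCoeff φ) (φ (colorVec n c₁) - δ) := by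
      intro c hc h
      have h1 : φ (colorVec n c -ᵥ colorVec n c₁) = 0 :=
        hφF (vsub_mem_vectorSpan ℝ (hmemF hc h) hc₁F)
      rw [vsub_eq_sub, map_sub, linearMap_colorVec φ n c] at h1
      linarith
    obtain ⟨hM, hb⟩ := hconst.coefficients hK1 hK2
      (fun i j => by simp only [edgeCoeff, eq_comm, add_comm]) (fun i => by simp [edgeCoeff])
      (fun w hw => by simp [repCoeff, hw]) hv4 hvn hu huv hex
    set κ := φ (colorVec n c₁) - δ
    have hφ : ∀ y ∈ colorVecs n K, φ y = κ * upperForm u v y + δ := by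
      rintro _ ⟨c, _, rfl⟩
      rw [linearMap_colorVec φ n c, upperForm_colorVec hv4 hvn hu huv, formValue]
      have hedge : ∀ i ∈ Finset.Icc 1 n, ∀ j ∈ Finset.Icc 1 n, edgeCoeff φ i j * sameInd c i j =
          (if i = u then if j = v then κ / 2 * sameInd c u v else 0 else 0)
          + (if i = v then if j = u then κ / 2 * sameInd c u v else 0 else 0) := by
        intro i hi j hj
        have hvu : sameInd c v u = sameInd c u v := by simp only [sameInd, eq_comm]
        rw [hM i hi j hj]
        by_cases h1 : i = u <;> by_cases h2 : i = v <;> by_cases h3 : j = u <;>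
          by_cases h4 : j = v <;> first | omega | (subst_vars; simp [*, huv.ne, huv.ne'])
      have hrep : ∀ w ∈ Finset.Icc 1 n, repCoeff φ w * repInd (Finset.Icc 1 n) c w =
          if w = v then κ * repInd (Finset.Icc 1 n) c v else 0 := by
        intro w hw
        rw [hb w hw]
        by_cases h : w = v <;> simp [h]
      rw [Finset.sum_congr rfl hrep,
        Finset.sum_congr rfl fun i hi => Finset.sum_congr rfl (hedge i hi)]
      simp only [Finset.sum_add_distrib, Finset.sum_ite_irrel, Finset.sum_ite_eq',
        Finset.sum_const_zero, hum, hvm, if_true]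
      ring
    have hker : vectorSpan ℝ (colorVecs n K) ≤ LinearMap.ker (φ - κ • upperForm u v) := by
      rw [vectorSpan_def, Submodule.span_le]
      rintro _ ⟨y, hy, z, hz, rfl⟩
      simp [hφ y hy, hφ z hz]
      ring
    have h0 := hker hx
    rw [SetLike.mem_coe, LinearMap.mem_ker] at hfx
    rw [LinearMap.mem_ker] at h0
    simp only [LinearMap.sub_apply, LinearMap.smul_apply, hfx, smul_zero, sub_zero] at h0
    exact hφx h0

/-- A second linear form that is constant on the face when `n = 5` and `{u,v} = {4,5}`. -/
def exceptionalForm : GPoint →ₗ[ℝ] ℝ where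
  toFun x := x.1 (1, 5) + x.1 (2, 5) + x.1 (3, 5) - x.1 (1, 2) - x.1 (1, 3) - x.1 (2, 3)
    - x.1 (4, 5) + 2 * x.2 4 + x.2 5
  map_add' x y := by simp only [Prod.fst_add, Prod.snd_add, Pi.add_apply]; ring
  map_smul' r x := by
    simp only [Prod.smul_fst, Prod.smul_snd, Pi.smul_apply, smul_eq_mul, RingHom.id_apply]; ring

theorem exceptionalForm_colorVec (c : ℕ → ℕ) : exceptionalForm (colorVec 5 c) =
    sameInd c 1 5 + sameInd c 2 5 + sameInd c 3 5 - sameInd c 1 2 - sameInd c 1 3 - sameInd c 2 3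
    - sameInd c 4 5 + 2 * repInd (Finset.Icc 1 5) c 4 + repInd (Finset.Icc 1 5) c 5 := rfl

theorem exceptionalForm_bounds {c : ℕ → ℕ} (hc : IsColoring (Finset.Icc 1 5) 3 c) :
    0 ≤ exceptionalForm (colorVec 5 c) ∧
      exceptionalForm (colorVec 5 c) ≤ 3 * (1 - upperForm 4 5 (colorVec 5 c)) := by
  have key : ∀ a₁ a₂ a₃ a₄ a₅ : Fin 3,
      (∀ t : Fin 3, a₁ = t ∨ a₂ = t ∨ a₃ = t ∨ a₄ = t ∨ a₅ = t) →
      let s : Fin 3 → Fin 3 → ℤ := fun a b => if a = b then 1 else 0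
      let r₄ : ℤ := if a₁ ≠ a₄ ∧ a₂ ≠ a₄ ∧ a₃ ≠ a₄ then 1 else 0
      let r₅ : ℤ := if a₁ ≠ a₅ ∧ a₂ ≠ a₅ ∧ a₃ ≠ a₅ ∧ a₄ ≠ a₅ then 1 else 0
      let g := s a₁ a₅ + s a₂ a₅ + s a₃ a₅ - s a₁ a₂ - s a₁ a₃ - s a₂ a₃ - s a₄ a₅ + 2 * r₄ + r₅
      0 ≤ g ∧ g ≤ 3 * (1 - (s a₄ a₅ + r₅)) := by
    decide +kernel
  have hlt : ∀ i, 1 ≤ i → i ≤ 5 → c i < 3 := fun i h1 h2 => hc.1 i (Finset.mem_Icc.2 ⟨h1, h2⟩)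
  have h := key ⟨c 1, hlt 1 (by omega) (by omega)⟩ ⟨c 2, hlt 2 (by omega) (by omega)⟩
    ⟨c 3, hlt 3 (by omega) (by omega)⟩ ⟨c 4, hlt 4 (by omega) (by omega)⟩
    ⟨c 5, hlt 5 (by omega) (by omega)⟩ (by
      rintro ⟨t, ht⟩
      obtain ⟨i, hi, hit⟩ := hc.2 t ht
      rw [Finset.mem_Icc] at hi
      obtain ⟨h1, h5⟩ := hi
      simp only [Fin.mk.injEq]
      interval_cases i <;> simp [hit])
  have h4 : (∀ z ∈ Finset.Icc 1 5, z < 4 → c z ≠ c 4) ↔ c 1 ≠ c 4 ∧ c 2 ≠ c 4 ∧ c 3 ≠ c 4 := by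
    simp [show Finset.Icc 1 5 = ({1, 2, 3, 4, 5} : Finset ℕ) from rfl]
  have h5 : (∀ z ∈ Finset.Icc 1 5, z < 5 → c z ≠ c 5) ↔
      c 1 ≠ c 5 ∧ c 2 ≠ c 5 ∧ c 3 ≠ c 5 ∧ c 4 ≠ c 5 := by
    simp [show Finset.Icc 1 5 = ({1, 2, 3, 4, 5} : Finset ℕ) from rfl]
  rw [exceptionalForm_colorVec, upperForm_colorVec (by omega) (by omega) (by omega) (by omega)]
  simp only [sameInd, repInd, h4, h5]
  simp only [ne_eq, Fin.mk.injEq] at h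
  exact_mod_cast h

/-- For `n = 5` and `{u,v} = {4,5}` the face has codimension at least two. -/
theorem vectorSpan_face_ne :
    vectorSpan ℝ {x | x ∈ convexHull ℝ (colorVecs 5 3) ∧ upperForm 4 5 x = 1} ≠
      vectorSpan ℝ (colorVecs 5 3) ⊓ LinearMap.ker (upperForm 4 5) := by
  intro h
  have hge : ∀ x ∈ convexHull ℝ (colorVecs 5 3), 0 ≤ exceptionalForm x := by
    refine convexHull_min (t := {x | 0 ≤ exceptionalForm x}) ?_
      (convex_halfSpace_ge exceptionalForm.isLinear 0)
    rintro _ ⟨c, hc, rfl⟩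
    exact (exceptionalForm_bounds hc).1
  have hle : ∀ x ∈ convexHull ℝ (colorVecs 5 3),
      (exceptionalForm + (3 : ℝ) • upperForm 4 5) x ≤ 3 := by
    refine convexHull_min (t := {x | (exceptionalForm + (3 : ℝ) • upperForm 4 5) x ≤ 3}) ?_
      (convex_halfSpace_le (exceptionalForm + (3 : ℝ) • upperForm 4 5).isLinear 3)
    rintro _ ⟨c, hc, rfl⟩
    have := (exceptionalForm_bounds hc).2
    simp only [Set.mem_ofPred_eq, LinearMap.add_apply, LinearMap.smul_apply, smul_eq_mul]
    linarith
  have hker : vectorSpan ℝ {x | x ∈ convexHull ℝ (colorVecs 5 3) ∧ upperForm 4 5 x = 1} ≤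
      LinearMap.ker exceptionalForm := by
    have hzero : ∀ x ∈ convexHull ℝ (colorVecs 5 3), upperForm 4 5 x = 1 →
        exceptionalForm x = 0 := by
      intro x hx hfx
      have h1 := hge x hx
      have h2 := hle x hx
      simp only [LinearMap.add_apply, LinearMap.smul_apply, smul_eq_mul, hfx] at h2
      linarith
    rw [vectorSpan_def, Submodule.span_le]
    rintro _ ⟨x, hx, y, hy, rfl⟩
    simp [hzero x hx.1 hx.2, hzero y hy.1 hy.2]
  let c : ℕ → ℕ := fun i => if i = 2 then 1 else if i = 3 ∨ i = 4 then 2 else 0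
  let c' : ℕ → ℕ := fun i => if i = 2 ∨ i = 3 then 1 else if i = 4 then 2 else 0
  have hc : IsColoring (Finset.Icc 1 5) 3 c := by unfold IsColoring; decide
  have hc' : IsColoring (Finset.Icc 1 5) 3 c' := by unfold IsColoring; decide
  have hcf : upperForm 4 5 (colorVec 5 c) = 0 :=
    upperForm_eq_zero (p := 1) (by omega) (by omega) (by omega) (by omega) (by decide) (by decide)
      (by omega) (by decide)
  have hcf' : upperForm 4 5 (colorVec 5 c') = 0 :=
    upperForm_eq_zero (p := 1) (by omega) (by omega) (by omega) (by omega) (by decide) (by decide)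
      (by omega) (by decide)
  have hmem : colorVec 5 c' -ᵥ colorVec 5 c ∈
      vectorSpan ℝ (colorVecs 5 3) ⊓ LinearMap.ker (upperForm 4 5) :=
    ⟨vsub_mem_vectorSpan ℝ ⟨c', hc', rfl⟩ ⟨c, hc, rfl⟩, by simp [hcf, hcf']⟩
  rw [← h] at hmem
  have h0 : exceptionalForm (colorVec 5 c' -ᵥ colorVec 5 c) = 0 := hker hmem
  have hr5 : repInd (Finset.Icc 1 5) c 5 = 0 :=
    repInd_eq_zero (z := 1) (by decide) (by omega) (by decide)
  have hr5' : repInd (Finset.Icc 1 5) c' 5 = 0 :=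
    repInd_eq_zero (z := 1) (by decide) (by omega) (by decide)
  have hr4 : repInd (Finset.Icc 1 5) c 4 = 0 :=
    repInd_eq_zero (z := 3) (by decide) (by omega) (by decide)
  have hr4' : repInd (Finset.Icc 1 5) c' 4 = 1 := repInd_eq_one (by decide)
  rw [vsub_eq_sub, map_sub, exceptionalForm_colorVec, exceptionalForm_colorVec, hr4, hr4', hr5,
    hr5'] at h0
  norm_num [sameInd, c, c'] at h0

theorem isFacetLe_upperForm_iff {n K u v : ℕ} (hK1 : 3 ≤ K) (hK2 : K + 2 ≤ n) (hv4 : 4 ≤ v)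
    (hvn : v ≤ n) (hu : 1 ≤ u) (huv : u < v) :
    IsFacetLe n K (fun x => x.1 (u, v) + x.2 v) 1 ↔
      vectorSpan ℝ {x | x ∈ convexHull ℝ (colorVecs n K) ∧ upperForm u v x = 1} =
        vectorSpan ℝ (colorVecs n K) ⊓ LinearMap.ker (upperForm u v) := by
  have hvm : v ∈ Finset.Icc 1 n := Finset.mem_Icc.2 (by omega)
  have hum : u ∈ Finset.Icc 1 n := Finset.mem_Icc.2 (by omega)
  obtain ⟨p, hp, hpu, hpv⟩ : ∃ p, 1 ≤ p ∧ p ≠ u ∧ p < v := by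
    by_cases h : u = 1
    · exact ⟨2, by omega⟩
    · exact ⟨1, by omega⟩
  have hpm : p ∈ Finset.Icc 1 n := Finset.mem_Icc.2 (by omega)
  obtain ⟨c₀, hc₀, hT₀⟩ := exists_coloring_with_class (T := {p, v}) hK1 hK2
    (Finset.insert_subset hpm (by simpa using hvm))
    (Finset.mem_insert_of_mem (Finset.mem_singleton_self v)) (Finset.card_le_two.trans (by omega))
  obtain ⟨c₁, hc₁, hT₁⟩ := exists_coloring_with_class (T := {u, v}) hK1 hK2
    (Finset.insert_subset hum (by simpa using hvm))
    (Finset.mem_insert_of_mem (Finset.mem_singleton_self v)) (Finset.card_le_two.trans (by omega))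
  have h₀ : upperForm u v (colorVec n c₀) ≠ 1 := by
    rw [upperForm_eq_zero hv4 hvn hu huv _ hpm hpv ((hT₀ p hpm).2 (by simp))]
    · exact zero_ne_one
    · rw [Ne, hT₀ u hum, Finset.mem_insert, Finset.mem_singleton]
      omega
  have h₁ : upperForm u v (colorVec n c₁) = 1 :=
    upperForm_eq_one hv4 hvn hu huv (Or.inl ((hT₁ u hum).2 (by simp)))
  rw [← adim_face_add_one_iff (finite_colorVecs n K) (upperForm u v) ⟨c₀, hc₀, rfl⟩ ⟨c₁, hc₁, rfl⟩
    h₀ h₁]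
  unfold IsFacetLe PolyP
  rw [setOf_charVec_eq]
  exact and_iff_right (upperForm_le_one hv4 hvn hu huv)

/-- For `n ≥ 5`, `3 ≤ K ≤ n-2`, `v ∈ {4,…,n}` and `u ∈ V` with `u < v`, the upper
representative inequality `x_{u,v} + x_v ≤ 1` is facet-defining for `P_{n,K}` iff
`n ≥ 6` or `{u,v} ≠ {4,5}`. -/
theorem upper_rep_facet (n K u v : ℕ) (hn : 5 ≤ n) (hK1 : 3 ≤ K) (hK2 : K ≤ n - 2)
    (hv : v ∈ Finset.Icc 4 n) (hu : u ∈ Finset.Icc 1 n) (huv : u < v) :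
    IsFacetLe n K (fun x => x.1 (u, v) + x.2 v) 1 ↔
      (6 ≤ n ∨ ({u, v} : Finset ℕ) ≠ {4, 5}) := by
  rw [Finset.mem_Icc] at hu hv
  rw [isFacetLe_upperForm_iff hK1 (by omega) hv.1 hv.2 hu.1 huv]
  constructor
  · intro h
    by_contra! hcon
    have hu4 : u ∈ ({4, 5} : Finset ℕ) := hcon.2 ▸ (by simp)
    have hv4 : v ∈ ({4, 5} : Finset ℕ) := hcon.2 ▸ (by simp)
    simp only [Finset.mem_insert, Finset.mem_singleton] at hu4 hv4
    obtain ⟨rfl, rfl, rfl, rfl⟩ : n = 5 ∧ K = 3 ∧ u = 4 ∧ v = 5 := by omega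
    exact vectorSpan_face_ne h
  · intro h
    refine vectorSpan_face_eq hK1 (by omega) hv.1 hv.2 hu.1 huv ?_
    by_contra! hcon
    obtain ⟨rfl, rfl⟩ : u = 4 ∧ v = 5 := by omega
    rcases h with h | h
    · omega
    · exact h rfl
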